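/- arXiv:2001.00045 — 5 statements merged into one kernel-verified Lean document; each statement's English description precedes it below -/
import Mathlib

section
/- Let R be a commutative integral domain with fraction field K, let n > 0, and let M₁ and M₂ be finitely generated projective R-modules such that dim_K (M₁ ⊗_R K) = dim_K (M₂ ⊗_R K) = n. Suppose F : End_R(M₁) → End_R(M₂) is an isomorphism of R-algebras. Then there exist an invertible R-module L (i.e., an R-module admitting an R-module L′ with L ⊗_R L′ ≅ R; equivalently, finitely generated projective of constant rank one) and an R-linear isomorphism g : M₁ → M₂ ⊗_R L such that (F(T) ⊗ id_L) ∘ g = g ∘ T for every T ∈ End_R(M₁). -/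
open scoped TensorProduct

universe u v

open Module

section Morita

variable {R : Type*} [CommRing R]

theorem Ideal.eq_top_of_smul_top_eq_top (M : Type*) [AddCommGroup M] [Module R M]
    [Module.Finite R M] [FaithfulSMul R M] {I : Ideal R} (h : I • (⊤ : Submodule R M) = ⊤) :
    I = ⊤ := by
  obtain ⟨r, hr, hr0⟩ := Submodule.exists_sub_one_mem_and_smul_eq_zero_of_fg_of_le_smul I
    (⊤ : Submodule R M) Module.Finite.fg_top h.ge
  have : r = 0 := FaithfulSMul.eq_of_smul_eq_smul (α := M) fun m => by
    rw [hr0 m trivial, zero_smul]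
  rw [Ideal.eq_top_iff_one]
  simpa [this] using I.neg_mem hr

variable {M N : Type*} [AddCommGroup M] [Module R M] [AddCommGroup N] [Module R N]

variable (R M) in
theorem Module.exists_finite_dual_basis [Module.Finite R M] [Module.Projective R M] :
    ∃ (n : ℕ) (x : Fin n → M) (f : Fin n → Dual R M), ∀ m, ∑ i, f i m • x i = m := by
  obtain ⟨n, p, s, -, -, h⟩ := Module.Finite.exists_comp_eq_id_of_projective R M
  refine ⟨n, fun i => p (Pi.single i 1), fun i => LinearMap.proj i ∘ₗ s, fun m => ?_⟩
  have hm : p (s m) = m := LinearMap.congr_fun h m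
  conv_rhs => rw [← hm, pi_eq_sum_univ' (s m), map_sum]
  refine Finset.sum_congr rfl fun i _ => ?_
  rw [map_smul]
  congr 2

variable (R M) in
/-- The trace ideal of a faithful finite projective module is the unit ideal. -/
theorem Module.span_dual_apply_eq_top [Module.Finite R M] [Module.Projective R M]
    [FaithfulSMul R M] : Ideal.span {r : R | ∃ (f : Dual R M) (x : M), f x = r} = ⊤ := by
  refine Ideal.eq_top_of_smul_top_eq_top M (eq_top_iff.2 fun m _ => ?_)
  obtain ⟨n, x, f, h⟩ := exists_finite_dual_basis R M
  rw [← h m]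
  exact Submodule.sum_mem _ fun i _ =>
    Submodule.smul_mem_smul (Ideal.subset_span ⟨f i, m, rfl⟩) trivial

theorem Module.End.exists_eq_smul_of_forall_commute [Module.Finite R M] [Module.Projective R M]
    [FaithfulSMul R M] (S : End R M) (hS : ∀ T : End R M, ∀ m, S (T m) = T (S m)) :
    ∃ c : R, ∀ m, S m = c • m := by
  suffices ∀ r ∈ Ideal.span {r : R | ∃ (f : Dual R M) (x : M), f x = r},
      ∃ c : R, ∀ m, r • S m = c • m by
    simpa using this 1 (by rw [span_dual_apply_eq_top]; trivial)
  intro r hr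
  induction hr using Submodule.span_induction with
  | mem r hr =>
    obtain ⟨f, x, rfl⟩ := hr
    exact ⟨f (S x), fun m => by simpa using hS (f.smulRight m) x⟩
  | zero => exact ⟨0, by simp⟩
  | add a b _ _ ha hb =>
    obtain ⟨c, hc⟩ := ha
    obtain ⟨d, hd⟩ := hb
    exact ⟨c + d, fun m => by rw [add_smul, hc, hd, add_smul]⟩
  | smul a b _ hb =>
    obtain ⟨c, hc⟩ := hb
    exact ⟨a * c, fun m => by rw [smul_assoc, hc, mul_smul]⟩

/-- The linear maps `M → N` that intertwine the action of `End R M` on `M` with its action on `N`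
through `F`. -/
def Module.End.intertwiners (F : End R M ≃ₐ[R] End R N) : Submodule R (M →ₗ[R] N) where
  carrier := {ψ | ∀ T m, ψ (T m) = F T (ψ m)}
  add_mem' ha hb T m := by simp [ha T m, hb T m]
  zero_mem' T m := by simp
  smul_mem' c ψ h T m := by simp [h T m]

namespace Module.End.intertwiners

variable (F : End R M ≃ₐ[R] End R N)

theorem apply_apply (ψ : intertwiners F) (T : End R M) (m : M) :
    ψ.1 (T m) = F T (ψ.1 m) := ψ.2 T m

/-- The evaluation map `m ⊗ ψ ↦ ψ m`. -/
noncomputable def eval : M ⊗[R] intertwiners F →ₗ[R] N :=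
  TensorProduct.lift (intertwiners F).subtype.flip

@[simp]
theorem eval_tmul (m : M) (ψ : intertwiners F) : eval F (m ⊗ₜ ψ) = ψ.1 m := rfl

/-- A functional `f` on `M` and a vector `y` of `N` give the intertwiner sending `m` to the action
of the rank one endomorphism `m ⊗ f` on `y`. -/
def ofDual (f : Dual R M) : N →ₗ[R] intertwiners F where
  toFun y :=
    ⟨{ toFun := fun m => F (f.smulRight m) y
       map_add' := fun a b => by
        have : f.smulRight (a + b) = f.smulRight a + f.smulRight b := by ext; simp
        rw [this, map_add, LinearMap.add_apply]
       map_smul' := fun c a => by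
        have : f.smulRight (c • a) = c • f.smulRight a := by ext; exact smul_comm _ _ _
        rw [this, map_smul, LinearMap.smul_apply, RingHom.id_apply] },
      fun T m => by
        have : f.smulRight (T m) = T * f.smulRight m := by ext; simp
        change F (f.smulRight (T m)) y = F T (F (f.smulRight m) y)
        rw [this, map_mul, Module.End.mul_apply]⟩
  map_add' a b := by ext m; exact map_add (F (f.smulRight m)) a b
  map_smul' c a := by ext m; exact map_smul (F (f.smulRight m)) c a

theorem ofDual_apply (f : Dual R M) (y : N) (m : M) :
    (ofDual F f y).1 m = F (f.smulRight m) y := rfl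

theorem ofDual_coe_apply (f : Dual R M) (ψ : intertwiners F) (m : M) :
    ofDual F f (ψ.1 m) = f m • ψ := by
  ext x
  rw [ofDual_apply, ← apply_apply]
  simp

theorem eval_bijective [Module.Finite R M] [Module.Projective R M] :
    Function.Bijective (eval F) := by
  obtain ⟨n, x, f, h⟩ := exists_finite_dual_basis R M
  let G : N →ₗ[R] M ⊗[R] intertwiners F := ∑ i, TensorProduct.mk R M _ (x i) ∘ₗ ofDual F (f i)
  have hG (y : N) : G y = ∑ i, x i ⊗ₜ[R] ofDual F (f i) y := by simp [G]
  refine Function.bijective_iff_has_inverse.2 ⟨G, fun t => ?_, fun y => ?_⟩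
  · induction t with
    | zero => simp
    | add a b ha hb => rw [map_add, map_add, ha, hb]
    | tmul m ψ =>
      simp only [eval_tmul, hG, ofDual_coe_apply]
      conv_rhs => rw [← h m, TensorProduct.sum_tmul]
      simp only [TensorProduct.tmul_smul, TensorProduct.smul_tmul']
  · have hid : ∑ i, (f i).smulRight (x i) = (1 : End R M) := by
      ext m
      simpa using h m
    simp only [hG, map_sum, eval_tmul, ofDual_apply]
    rw [← LinearMap.sum_apply, ← map_sum, hid, map_one, Module.End.one_apply]

theorem exists_comp_eq_smul [Module.Finite R M] [Module.Projective R M] [FaithfulSMul R M]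
    (φ : intertwiners F.symm) (ψ : intertwiners F) : ∃ c : R, ∀ m, φ.1 (ψ.1 m) = c • m :=
  exists_eq_smul_of_forall_commute (φ.1 ∘ₗ ψ.1) fun T m => by
    simp [apply_apply]

variable [Module.Finite R M] [Module.Projective R M] [FaithfulSMul R M]

/-- The composition of intertwiners in both directions, as a scalar. -/
theorem exists_pairing : ∃ c : intertwiners F.symm ⊗[R] intertwiners F →ₗ[R] R,
    ∀ φ ψ m, φ.1 (ψ.1 m) = c (φ ⊗ₜ ψ) • m := by
  choose c hc using exists_comp_eq_smul F
  have ext {a b : R} (h : ∀ m : M, a • m = b • m) : a = b :=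
    FaithfulSMul.eq_of_smul_eq_smul (α := M) h
  refine ⟨TensorProduct.lift (LinearMap.mk₂ R c ?_ ?_ ?_ ?_), hc⟩
  · exact fun φ φ' ψ => ext fun m => by simp [add_smul, ← hc]
  · exact fun r φ ψ => ext fun m => by simp [mul_smul, ← hc]
  · exact fun φ ψ ψ' => ext fun m => by simp [add_smul, ← hc]
  · exact fun r φ ψ => ext fun m => by simp [mul_smul, ← hc]

theorem nonempty_tensor_equiv [Module.Finite R N] [Module.Projective R N] [FaithfulSMul R N] :
    Nonempty ((intertwiners F.symm ⊗[R] intertwiners F) ≃ₗ[R] R) := by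
  obtain ⟨c, hc⟩ := exists_pairing F
  have hrange : LinearMap.range c = ⊤ := by
    refine Ideal.eq_top_of_smul_top_eq_top M (eq_top_iff.2 fun m _ => ?_)
    obtain ⟨t, rfl⟩ := (eval_bijective F.symm).2 m
    induction t with
    | zero => simp
    | add a b ha hb => rw [map_add]; exact Submodule.add_mem _ (ha trivial) (hb trivial)
    | tmul y φ =>
      obtain ⟨s, rfl⟩ := (eval_bijective F).2 y
      induction s with
      | zero => simp
      | add a b ha hb =>
        rw [map_add, TensorProduct.add_tmul, map_add]
        exact Submodule.add_mem _ (ha trivial) (hb trivial)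
      | tmul x ψ =>
        rw [eval_tmul, eval_tmul, hc]
        exact Submodule.smul_mem_smul ⟨_, rfl⟩ trivial
  have hswap (s t) : c t • s = c s • t := by
    induction s with
    | zero => simp
    | add a b ha hb => rw [smul_add, ha, hb, map_add, add_smul]
    | tmul φ' ψ' =>
      induction t with
      | zero => simp
      | add a b ha hb => rw [smul_add, ← ha, ← hb, map_add, add_smul]
      | tmul φ ψ =>
        obtain ⟨d, hd⟩ := exists_eq_smul_of_forall_commute (ψ.1 ∘ₗ φ'.1) fun T y => by
          simp [apply_apply]
        have h₁ : c (φ ⊗ₜ ψ) • φ' = d • φ := by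
          ext y
          simpa [← hc] using congrArg φ.1 (hd y)
        have h₂ : c (φ' ⊗ₜ ψ') • ψ = d • ψ' := by
          ext m
          simpa [hc] using hd (ψ'.1 m)
        rw [TensorProduct.smul_tmul', h₁, ← TensorProduct.tmul_smul, h₂, TensorProduct.smul_tmul]
  refine ⟨LinearEquiv.ofBijective c ⟨?_, LinearMap.range_eq_top.1 hrange⟩⟩
  obtain ⟨s, hs⟩ := LinearMap.range_eq_top.1 hrange 1
  intro a b hab
  rw [← one_smul R a, ← one_smul R b, ← hs, ← hswap s a, ← hswap s b, hab]

end Module.End.intertwiners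

end Morita

theorem Module.faithfulSMul_of_finrank_tensorProduct_pos (R K M : Type*) [CommRing R] [IsDomain R]
    [Field K] [Algebra R K] [AddCommGroup M] [Module R M] [Module.Projective R M]
    (h : 0 < finrank K (K ⊗[R] M)) : FaithfulSMul R M := by
  have : Nontrivial M := by
    by_contra hM
    rw [not_nontrivial_iff_subsingleton] at hM
    have := Module.finrank_zero_of_subsingleton (R := K) (M := K ⊗[R] M)
    omega
  obtain ⟨m, hm⟩ := exists_ne (0 : M)
  exact ⟨fun h => smul_left_injective R hm (h m)⟩

/-- Let `R` be a commutative integral domain with fraction field `K`, `n > 0`,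
and `M₁`, `M₂` finitely generated projective `R`-modules whose base changes to `K` both have
dimension `n`.  Any `R`-algebra isomorphism `F : End_R(M₁) ≃ End_R(M₂)` is induced by an
`R`-linear isomorphism `g : M₁ ≃ M₂ ⊗ L` for some invertible `R`-module `L`, in the sense that
`(F T ⊗ id_L) ∘ g = g ∘ T` for all `T ∈ End_R(M₁)`. -/
theorem stmt0 (R : Type u) [CommRing R] [IsDomain R]
    (n : ℕ) (hn : 0 < n)
    (M₁ : Type v) [AddCommGroup M₁] [Module R M₁] [Module.Finite R M₁] [Module.Projective R M₁]
    (M₂ : Type v) [AddCommGroup M₂] [Module R M₂] [Module.Finite R M₂] [Module.Projective R M₂]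
    (h₁ : Module.finrank (FractionRing R) ((FractionRing R) ⊗[R] M₁) = n)
    (h₂ : Module.finrank (FractionRing R) ((FractionRing R) ⊗[R] M₂) = n)
    (F : Module.End R M₁ ≃ₐ[R] Module.End R M₂) :
    ∃ (L : Type v) (_ : AddCommGroup L) (_ : Module R L),
      (∃ (L' : Type v) (_ : AddCommGroup L') (_ : Module R L'),
          Nonempty ((L ⊗[R] L') ≃ₗ[R] R)) ∧
        ∃ g : M₁ ≃ₗ[R] M₂ ⊗[R] L,
          ∀ T : Module.End R M₁,
            (TensorProduct.map (F T) (LinearMap.id : L →ₗ[R] L)).comp g.toLinearMap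
              = g.toLinearMap.comp T := by
  have := Module.faithfulSMul_of_finrank_tensorProduct_pos R (FractionRing R) M₁ (h₁ ▸ hn)
  have := Module.faithfulSMul_of_finrank_tensorProduct_pos R (FractionRing R) M₂ (h₂ ▸ hn)
  refine ⟨End.intertwiners F.symm, inferInstance, inferInstance,
    ⟨End.intertwiners F, inferInstance, inferInstance, End.intertwiners.nonempty_tensor_equiv F⟩,
    (LinearEquiv.ofBijective _ (End.intertwiners.eval_bijective F.symm)).symm, fun T => ?_⟩
  rw [← LinearEquiv.toLinearMap_symm_comp_eq, LinearEquiv.symm_symm, ← LinearMap.comp_assoc,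
    LinearEquiv.comp_toLinearMap_symm_eq]
  ext y φ
  simp [End.intertwiners.apply_apply]
end

section
/- Let R be a commutative ring, T a finite abelian group, R[T] the group algebra of T over R, and M a finitely generated R[T]-module. Then the map β from Hom_R(M, R) to Hom_{R[T]}(M, R[T]) defined by β(λ)(m) = Σ_{t ∈ T} λ(t • m) · [t⁻¹] is well defined (i.e., β(λ) is R[T]-linear for every R-linear functional λ : M → R) and is a bijection. -/
namespace MonoidAlgebra

variable {R T M : Type*} [CommRing R] [CommGroup T] [Fintype T] [AddCommGroup M] [Module R M]
  [Module (MonoidAlgebra R T) M] [IsScalarTower R (MonoidAlgebra R T) M]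

/-- The `R[T]`-linear map `x ↦ ∑ t, l (t • x) · [t⁻¹]` attached to an `R`-linear functional `l`. -/
noncomputable def dualLift (l : M →ₗ[R] R) : M →ₗ[MonoidAlgebra R T] MonoidAlgebra R T :=
  equivariantOfLinearOfComm
    { toFun := fun x ↦ ∑ t : T, single t⁻¹ (l (of R T t • x))
      map_add' := fun x y ↦ by simp [smul_add, single_add, Finset.sum_add_distrib]
      map_smul' := fun r x ↦ by
        simp only [smul_comm _ r x, map_smul, ← smul_single, ← Finset.smul_sum, RingHom.id_apply] }
    fun g x ↦ by
      simp only [LinearMap.coe_mk, AddHom.coe_mk, of_apply, smul_smul, single_mul_single, mul_one,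
        smul_eq_mul, Finset.mul_sum, one_mul]
      exact Fintype.sum_equiv (Equiv.mulRight g) _ _ fun t ↦ by simp

lemma dualLift_apply (l : M →ₗ[R] R) (x : M) :
    dualLift (T := T) l x = ∑ t : T, single t⁻¹ (l (of R T t • x)) := rfl

lemma coeff_dualLift_apply (l : M →ₗ[R] R) (x : M) (t : T) :
    (dualLift (T := T) l x).coeff t = l (of R T t⁻¹ • x) := by
  classical
  simp [dualLift_apply, coeff_sum, Finsupp.single_apply, inv_eq_iff_eq_inv]

lemma dualLift_bijective :
    Function.Bijective (dualLift : (M →ₗ[R] R) → M →ₗ[MonoidAlgebra R T] MonoidAlgebra R T) := by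
  refine ⟨fun l l' h ↦ LinearMap.ext fun x ↦ ?_, fun f ↦ ⟨?_, ?_⟩⟩
  · simpa [coeff_dualLift_apply, ← one_def] using congrArg (fun f ↦ (f x).coeff 1) h
  · exact
      { toFun := fun x ↦ (f x).coeff 1
        map_add' := fun x y ↦ by simp
        map_smul' := fun r x ↦ by simp [LinearMap.map_smul_of_tower] }
  · ext x t
    simp [coeff_dualLift_apply]

end MonoidAlgebra

/-- Let `R` be a commutative ring, `T` a finite abelian group, `R[T]` the group
algebra, and `M` a finitely generated `R[T]`-module.  The map
`β : Hom_R(M, R) → Hom_{R[T]}(M, R[T])` given by `β(l)(x) = ∑_{t ∈ T} l(t • x) · [t⁻¹]` is well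
defined (i.e. `β(l)` is `R[T]`-linear for every `R`-linear `l`) and bijective. -/
theorem stmt2 (R : Type*) [CommRing R] (T : Type*) [CommGroup T] [Fintype T]
    (M : Type*) [AddCommGroup M] [Module R M] [Module (MonoidAlgebra R T) M]
    [IsScalarTower R (MonoidAlgebra R T) M] [Module.Finite (MonoidAlgebra R T) M] :
    ∃ β : (M →ₗ[R] R) → (M →ₗ[MonoidAlgebra R T] MonoidAlgebra R T),
      (∀ (l : M →ₗ[R] R) (x : M),
          β l x = ∑ t : T, MonoidAlgebra.single t⁻¹ (l (MonoidAlgebra.of R T t • x))) ∧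
      Function.Bijective β := by
  exact ⟨MonoidAlgebra.dualLift, MonoidAlgebra.dualLift_apply, MonoidAlgebra.dualLift_bijective⟩
end

section
/- Let R be a commutative Noetherian ring, M a finitely generated R-module, and s an element of M. Then the zero locus of s, namely the set V(s) = { p ∈ Spec R : the image of s in M ⊗_R κ(p) is zero }, is a constructible subset of the prime spectrum Spec R with its Zariski topology. -/
open scoped TensorProduct

/-- A finite union of locally closed subsets. -/
def IsFiniteUnionLocallyClosed {X : Type*} [TopologicalSpace X] (T : Set X) : Prop :=
  ∃ F : Set (Set X), F.Finite ∧ (∀ U ∈ F, IsLocallyClosed U) ∧ T = ⋃₀ F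

namespace IsFiniteUnionLocallyClosed

variable {X : Type*} [TopologicalSpace X]

lemma empty : IsFiniteUnionLocallyClosed (∅ : Set X) :=
  ⟨∅, Set.finite_empty, by simp, by simp⟩

lemma of_isLocallyClosed {T : Set X} (hT : IsLocallyClosed T) : IsFiniteUnionLocallyClosed T :=
  ⟨{T}, Set.finite_singleton T, by simpa using hT, by simp⟩

lemma union {S T : Set X} (hS : IsFiniteUnionLocallyClosed S)
    (hT : IsFiniteUnionLocallyClosed T) : IsFiniteUnionLocallyClosed (S ∪ T) := by
  obtain ⟨F, hF, hF', rfl⟩ := hS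
  obtain ⟨G, hG, hG', rfl⟩ := hT
  refine ⟨F ∪ G, hF.union hG, ?_, (Set.sUnion_union F G).symm⟩
  rintro U (hU | hU)
  exacts [hF' U hU, hG' U hU]

lemma exists_iUnion_fin {T : Set X} (hT : IsFiniteUnionLocallyClosed T) :
    ∃ (n : ℕ) (U : Fin n → Set X), (∀ i, IsLocallyClosed (U i)) ∧ T = ⋃ i, U i := by
  obtain ⟨F, hF, hF', rfl⟩ := hT
  obtain ⟨n, U, -, rfl⟩ := hF.fin_param
  exact ⟨n, U, fun i ↦ hF' _ ⟨i, rfl⟩, Set.sUnion_range U⟩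

end IsFiniteUnionLocallyClosed

/-- A subset of the spectrum of a Noetherian ring is a finite union of locally closed subsets
if its intersection with every irreducible closed subset either contains, or is disjoint from, a
nonempty open subset of it. -/
lemma PrimeSpectrum.isFiniteUnionLocallyClosed_of_generic {R : Type*} [CommRing R]
    [IsNoetherianRing R] (S : Set (PrimeSpectrum R))
    (h : ∀ q : PrimeSpectrum R, ∃ f ∉ q.asIdeal,
      (∀ p : PrimeSpectrum R, q ≤ p → f ∉ p.asIdeal → p ∈ S) ∨
      (∀ p : PrimeSpectrum R, q ≤ p → f ∉ p.asIdeal → p ∉ S)) :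
    IsFiniteUnionLocallyClosed S := by
  suffices H : ∀ I : Ideal R, IsFiniteUnionLocallyClosed (zeroLocus (I : Set R) ∩ S) by
    simpa using H ⊥
  intro I
  induction I using IsNoetherian.induction with
  | hgt I ih =>
  have ih' (a : R) (ha : a ∉ I) :
      IsFiniteUnionLocallyClosed (zeroLocus ((I ⊔ Ideal.span {a} : Ideal R) : Set R) ∩ S) :=
    ih _ (lt_of_le_of_ne le_sup_left fun e ↦
      ha (e ▸ Ideal.mem_sup_right (Ideal.mem_span_singleton_self a)))
  have mem (a : R) (p : PrimeSpectrum R) :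
      p ∈ zeroLocus ((I ⊔ Ideal.span {a} : Ideal R) : Set R) ↔
        p ∈ zeroLocus (I : Set R) ∧ a ∈ p.asIdeal := by
    simp [mem_zeroLocus, SetLike.coe_subset_coe, Ideal.span_le]
  by_cases hI : Ideal.IsPrime I
  · obtain ⟨f, hf, hfS⟩ := h ⟨I, hI⟩
    rcases hfS with hfS | hfS
    · have hlc : IsLocallyClosed (zeroLocus (I : Set R) ∩ (basicOpen f : Set (PrimeSpectrum R))) :=
        (isClosed_zeroLocus _).isLocallyClosed.inter (basicOpen f).isOpen.isLocallyClosed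
      convert (IsFiniteUnionLocallyClosed.of_isLocallyClosed hlc).union (ih' f hf) using 1
      ext p
      simp only [Set.mem_inter_iff, Set.mem_union, mem, SetLike.mem_coe, mem_basicOpen]
      have key : p ∈ zeroLocus (I : Set R) → f ∉ p.asIdeal → p ∈ S := hfS p
      tauto
    · convert ih' f hf using 1
      ext p
      simp only [Set.mem_inter_iff, mem]
      have key : p ∈ zeroLocus (I : Set R) → f ∉ p.asIdeal → p ∉ S := hfS p
      tauto
  · rcases Ideal.not_isPrime_iff.mp hI with rfl | ⟨a, ha, b, hb, hab⟩
    · simpa using IsFiniteUnionLocallyClosed.empty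
    · convert (ih' a ha).union (ih' b hb) using 1
      ext p
      simp only [Set.mem_inter_iff, Set.mem_union, mem]
      have key : p ∈ zeroLocus (I : Set R) → a ∈ p.asIdeal ∨ b ∈ p.asIdeal :=
        fun hp ↦ p.2.mem_or_mem (hp hab)
      tauto

section Fibre

variable {R : Type*} [CommRing R] {M : Type*} [AddCommGroup M] [Module R M]

/-- If an element of a module over `R` vanishes after base change to the fraction field of an
`R`-algebra `A` that is a domain, then a nonzero multiple vanishes over `A`. -/
lemma exists_ne_zero_tmul_eq_zero_of_fraction_tmul_eq_zero {A K : Type*} [CommRing A] [IsDomain A]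
    [Algebra R A] [Field K] [Algebra A K] [IsFractionRing A K] [Algebra R K] [IsScalarTower R A K]
    {s : M} (hs : (1 : K) ⊗ₜ[R] s = 0) : ∃ a : A, a ≠ 0 ∧ a ⊗ₜ[R] s = 0 := by
  have h : TensorProduct.mk A K (A ⊗[R] M) 1 (1 ⊗ₜ[R] s) = 0 := by
    apply (TensorProduct.AlgebraTensorModule.cancelBaseChange R A A K M).injective
    simpa using hs
  obtain ⟨a, ha⟩ := (IsLocalizedModule.eq_zero_iff (nonZeroDivisors A)
    (TensorProduct.mk A K (A ⊗[R] M) 1)).mp h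
  exact ⟨a, nonZeroDivisors.ne_zero a.2, by
    simpa [Submonoid.smul_def, TensorProduct.smul_tmul'] using ha⟩

/-- If an element of a finite module over `R` does not vanish after base change to the fraction
field of an `R`-algebra `A`, then it is detected by a linear map to `A`. -/
lemma exists_linearMap_ne_zero_of_fraction_tmul_ne_zero [Module.Finite R M] {A K : Type*}
    [CommRing A] [IsDomain A] [Algebra R A] [Field K] [Algebra A K] [IsFractionRing A K]
    [Algebra R K] [IsScalarTower R A K] {s : M} (hs : (1 : K) ⊗ₜ[R] s ≠ 0) :
    ∃ φ : M →ₗ[R] A, φ s ≠ 0 := by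
  classical
  obtain ⟨ψ, hψ⟩ : ∃ ψ : Module.Dual K (K ⊗[R] M), ψ (1 ⊗ₜ[R] s) ≠ 0 := by
    by_contra! h
    exact hs ((Module.forall_dual_apply_eq_zero_iff K _).mp h)
  let ψ' : M →ₗ[R] K := ψ.restrictScalars R ∘ₗ TensorProduct.mk R K M 1
  obtain ⟨t, ht⟩ := Module.Finite.fg_top (R := R) (M := M)
  obtain ⟨b, hb⟩ := IsLocalization.exist_integer_multiples_of_finset (nonZeroDivisors A)
    (t.image ψ')
  let χ : M →ₗ[R] K := (LinearMap.lsmul A K (b : A)).restrictScalars R ∘ₗ ψ'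
  let ι : A →ₗ[R] K := (IsScalarTower.toAlgHom R A K).toLinearMap
  have hι : Function.Injective ι := IsFractionRing.injective A K
  have hχ (m : M) : χ m ∈ LinearMap.range ι := by
    have hle : (⊤ : Submodule R M) ≤ (LinearMap.range ι).comap χ := by
      rw [← ht, Submodule.span_le]
      intro m hm
      obtain ⟨a, ha⟩ := hb (ψ' m) (Finset.mem_image_of_mem ψ' hm)
      exact ⟨a, ha⟩
    exact hle trivial
  let e := LinearEquiv.ofInjective ι hι
  refine ⟨e.symm.toLinearMap ∘ₗ χ.codRestrict _ hχ, fun h ↦ ?_⟩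
  have h0 : χ.codRestrict _ hχ s = 0 := e.symm.map_eq_zero_iff.mp h
  have h1 : (b : A) • ψ' s = 0 := congrArg Subtype.val h0
  rcases smul_eq_zero.mp h1 with h2 | h2
  exacts [nonZeroDivisors.ne_zero b.2 h2, hψ h2]

/-- The canonical map from `R ⧸ I` to a field over `R ⧸ p`, for an ideal `p` containing `I`. -/
noncomputable def Ideal.quotientToResidue (I p : Ideal R) (hIp : I ≤ p) (L : Type*)
    [Field L] [Algebra (R ⧸ p) L] [Algebra R L] [IsScalarTower R (R ⧸ p) L] :
    (R ⧸ I) →ₐ[R] L :=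
  (IsScalarTower.toAlgHom R (R ⧸ p) L).comp (Ideal.Quotient.factorₐ R hIp)

lemma algebraMap_eq_zero_iff_mem_of_isFractionRing (p : Ideal R) (L : Type*)
    [Field L] [Algebra (R ⧸ p) L] [IsFractionRing (R ⧸ p) L] [Algebra R L]
    [IsScalarTower R (R ⧸ p) L] (r : R) : algebraMap R L r = 0 ↔ r ∈ p := by
  rw [IsScalarTower.algebraMap_apply R (R ⧸ p) L,
    FaithfulSMul.algebraMap_eq_zero_iff, Ideal.Quotient.algebraMap_eq,
    Ideal.Quotient.eq_zero_iff_mem]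

/-- Generically on an irreducible closed subset, either all fibres of `s` vanish or none do. -/
lemma exists_notMem_forall_tmul_eq_zero_or_forall_ne_zero [Module.Finite R M] (s : M)
    (K : PrimeSpectrum R → Type*) [∀ p, Field (K p)] [∀ p, Algebra (R ⧸ p.asIdeal) (K p)]
    [∀ p, IsFractionRing (R ⧸ p.asIdeal) (K p)] [∀ p, Algebra R (K p)]
    [∀ p, IsScalarTower R (R ⧸ p.asIdeal) (K p)] (q : PrimeSpectrum R) :
    ∃ f ∉ q.asIdeal,
      (∀ p : PrimeSpectrum R, q ≤ p → f ∉ p.asIdeal → (1 : K p) ⊗ₜ[R] s = 0) ∨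
      (∀ p : PrimeSpectrum R, q ≤ p → f ∉ p.asIdeal → (1 : K p) ⊗ₜ[R] s ≠ 0) := by
  by_cases hs : (1 : K q) ⊗ₜ[R] s = 0
  · obtain ⟨a, ha, has⟩ := exists_ne_zero_tmul_eq_zero_of_fraction_tmul_eq_zero
      (A := R ⧸ q.asIdeal) hs
    obtain ⟨f, rfl⟩ := Ideal.Quotient.mk_surjective a
    refine ⟨f, fun h ↦ ha (Ideal.Quotient.eq_zero_iff_mem.mpr h), .inl fun p hqp hf ↦ ?_⟩
    have h := congrArg
      ((Ideal.quotientToResidue q.asIdeal p.asIdeal hqp (K p)).toLinearMap.rTensor M) has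
    have h' : algebraMap R (K p) f ⊗ₜ[R] s = 0 := by
      rw [← (Ideal.quotientToResidue q.asIdeal p.asIdeal hqp (K p)).commutes f]
      simpa using h
    have hf' : algebraMap R (K p) f ≠ 0 :=
      (algebraMap_eq_zero_iff_mem_of_isFractionRing p.asIdeal (K p) f).not.mpr hf
    refine (smul_eq_zero_iff_right hf').mp ?_
    rwa [TensorProduct.smul_tmul', smul_eq_mul, mul_one]
  · obtain ⟨φ, hφ⟩ := exists_linearMap_ne_zero_of_fraction_tmul_ne_zero (A := R ⧸ q.asIdeal) hs
    obtain ⟨f, hf⟩ := Ideal.Quotient.mk_surjective (φ s)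
    refine ⟨f, fun h ↦ hφ (hf ▸ Ideal.Quotient.eq_zero_iff_mem.mpr h), .inr fun p hqp hfp h ↦ ?_⟩
    refine hfp ((algebraMap_eq_zero_iff_mem_of_isFractionRing p.asIdeal (K p) f).mp ?_)
    let g := Ideal.quotientToResidue q.asIdeal p.asIdeal hqp (K p)
    have h' := congrArg (TensorProduct.lift
      ((LinearMap.mul R (K p)).compl₂ (g.toLinearMap ∘ₗ φ))) h
    have h'' : g (φ s) = 0 := by simpa using h'
    rw [← hf] at h''
    rw [← g.commutes f]
    exact h''

end Fibre

/-- Let `R` be a commutative Noetherian ring, `M` a finitely generated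
`R`-module and `s ∈ M`.  The zero locus
`V(s) = {p ∈ Spec R | image of s in M ⊗ κ(p) is zero}` (with `κ(p)` the residue field at `p`,
realized as the fraction field of `R ⧸ p`) is constructible, i.e. a finite union of locally
closed subsets of `Spec R`. -/
theorem stmt5 (R : Type*) [CommRing R] [IsNoetherianRing R]
    (M : Type*) [AddCommGroup M] [Module R M] [Module.Finite R M] (s : M) :
    ∃ (n : ℕ) (U : Fin n → Set (PrimeSpectrum R)),
      (∀ i, IsLocallyClosed (U i)) ∧
      {p : PrimeSpectrum R |
          letI : Algebra R (FractionRing (R ⧸ p.asIdeal)) :=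
            ((algebraMap (R ⧸ p.asIdeal) (FractionRing (R ⧸ p.asIdeal))).comp
              (Ideal.Quotient.mk p.asIdeal)).toAlgebra
          ((1 : FractionRing (R ⧸ p.asIdeal)) ⊗ₜ[R] s :
            (FractionRing (R ⧸ p.asIdeal)) ⊗[R] M) = 0}
        = ⋃ i, U i := by
  exact (PrimeSpectrum.isFiniteUnionLocallyClosed_of_generic _
    (exists_notMem_forall_tmul_eq_zero_or_forall_ne_zero s
      fun p ↦ FractionRing (R ⧸ p.asIdeal))).exists_iUnion_fin
end

section
/- Let R be a nonzero reduced commutative Noetherian ring, M a finitely generated R-module, and s an element of M. If the zero locus V(s) = { p ∈ Spec R : the image of s in M ⊗_R κ(p) is zero } is dense in Spec R for the Zariski topology, then s is a torsion element: there exists r ∈ R with r ≠ 0 and r • s = 0. -/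
open scoped TensorProduct

/-- If `n ⊗ s` vanishes, then every linear functional sends `s` into the annihilator of `n`. -/
theorem dual_apply_smul_eq_zero_of_tmul_eq_zero {R N M : Type*} [CommRing R]
    [AddCommMonoid N] [Module R N] [AddCommGroup M] [Module R M] {n : N} {s : M}
    (h : n ⊗ₜ[R] s = 0) (φ : Module.Dual R M) : φ s • n = 0 := by
  simpa using congrArg ((TensorProduct.rid R N).toLinearMap ∘ₗ φ.lTensor N) h

/-- Over a reduced ring, an element of a finitely presented module that is killed by all linear
functionals is killed by an element outside of any given minimal prime. -/
theorem exists_notMem_smul_eq_zero_of_forall_dual_eq_zero {R M : Type*} [CommRing R] [IsReduced R]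
    [AddCommGroup M] [Module R M] [Module.FinitePresentation R M] {s : M}
    (hs : ∀ φ : Module.Dual R M, φ s = 0) {p : Ideal R} (hp : p ∈ minimalPrimes R) :
    ∃ r ∉ p, r • s = 0 := by
  have := hp.1.1
  have := Ring.KrullDimLE.of_isLocalization p hp (Localization.AtPrime p)
  let := (Ring.KrullDimLE.isField_of_isReduced (R := Localization.AtPrime p)).toField
  have h : LocalizedModule.mkLinearMap p.primeCompl M s = 0 := by
    rw [← Module.forall_dual_apply_eq_zero_iff (Localization.AtPrime p)]
    intro ψ
    obtain ⟨φ, t, hφ⟩ := Module.FinitePresentation.exists_lift_of_isLocalizedModule p.primeCompl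
      (Algebra.linearMap R (Localization.AtPrime p))
      (ψ.restrictScalars R ∘ₗ LocalizedModule.mkLinearMap p.primeCompl M)
    have ht := LinearMap.congr_fun hφ s
    simp only [LinearMap.comp_apply, hs, map_zero, LinearMap.smul_apply] at ht
    exact IsLocalizedModule.smul_injective (Algebra.linearMap R _) t (by simpa using ht.symm)
  obtain ⟨r, hr⟩ := (IsLocalizedModule.eq_zero_iff p.primeCompl _).mp h
  exact ⟨r, r.2, hr⟩

/-- Let `R` be a nonzero reduced commutative Noetherian ring, `M` a finitely
generated `R`-module and `s ∈ M`.  If the zero locus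
`V(s) = {p ∈ Spec R | image of s in M ⊗ κ(p) is zero}` (with `κ(p)` the residue field at `p`,
realized as the fraction field of `R ⧸ p`) is Zariski-dense in `Spec R`, then `s` is a torsion
element: there is `r ∈ R`, `r ≠ 0`, with `r • s = 0`. -/
theorem stmt6 (R : Type*) [CommRing R] [Nontrivial R] [IsReduced R] [IsNoetherianRing R]
    (M : Type*) [AddCommGroup M] [Module R M] [Module.Finite R M] (s : M)
    (hdense : Dense {p : PrimeSpectrum R |
        letI : Algebra R (FractionRing (R ⧸ p.asIdeal)) :=
          ((algebraMap (R ⧸ p.asIdeal) (FractionRing (R ⧸ p.asIdeal))).comp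
            (Ideal.Quotient.mk p.asIdeal)).toAlgebra
        ((1 : FractionRing (R ⧸ p.asIdeal)) ⊗ₜ[R] s :
          (FractionRing (R ⧸ p.asIdeal)) ⊗[R] M) = 0}) :
    ∃ r : R, r ≠ 0 ∧ r • s = 0 := by
  have hφ (φ : Module.Dual R M) : φ s = 0 := by
    rw [← Ideal.mem_bot, ← Ideal.zero_eq_bot, ← nilradical_eq_zero R,
      ← PrimeSpectrum.vanishingIdeal_univ, ← hdense.closure_eq,
      PrimeSpectrum.vanishingIdeal_closure, PrimeSpectrum.mem_vanishingIdeal]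
    intro p hp
    have h := dual_apply_smul_eq_zero_of_tmul_eq_zero hp φ
    rwa [← algebraMap_smul (R ⧸ p.asIdeal), Algebra.smul_def, mul_one,
      map_eq_zero_iff _ (IsFractionRing.injective _ _), Ideal.Quotient.algebraMap_eq,
      Ideal.Quotient.eq_zero_iff_mem] at h
  obtain ⟨p, hp⟩ := Ideal.nonempty_minimalPrimes (bot_ne_top (α := Ideal R))
  have := Module.finitePresentation_of_finite R M
  obtain ⟨r, hr, hrs⟩ := exists_notMem_smul_eq_zero_of_forall_dual_eq_zero hφ hp
  exact ⟨r, fun h ↦ hr (h ▸ p.zero_mem), hrs⟩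
end

section
/- Let R be a commutative Noetherian ring, let C be a bounded cochain complex of finitely generated free R-modules, let p be a prime ideal of R with residue field κ(p), and let i₀ be an integer. Assume that H^i(C ⊗_R κ(p)) = 0 for all i ≥ i₀ + 1. Then: (1) for every i ≥ i₀ + 1, the localization H^i(C)_p vanishes, so p does not lie in the support of the finitely generated R-module H^i(C); and (2) the natural base-change map H^{i₀}(C) ⊗_R κ(p) → H^{i₀}(C ⊗_R κ(p)), sending [z] ⊗ λ to [z ⊗ λ], is an isomorphism of κ(p)-vector spaces. -/
open scoped TensorProduct

/-- The (co)homology-style subquotient `Z / (Z ∩ B)` of a pair of submodules `Z, B` of an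
ambient module: the quotient of `Z` by the preimage of `B` under the inclusion `Z ↪ V`.
When `B ≤ Z` (e.g. cocycles and coboundaries of a complex) this is the usual quotient `Z/B`. -/
abbrev subquot {F V : Type*} [Ring F] [AddCommGroup V] [Module F V]
    (Z B : Submodule F V) : Type _ :=
  ↥Z ⧸ Submodule.comap Z.subtype B

section Splitting

variable {R : Type*} [CommRing R] {X Y W : Type*} [AddCommGroup X] [AddCommGroup Y]
  [AddCommGroup W] [Module R X] [Module R Y] [Module R W]

/-- If `g ∘ h ∘ g = s • g`, then `s • id - h ∘ g` corestricts to a map `Y → ker g`. -/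
def kerRetraction (g : Y →ₗ[R] W) (h : W →ₗ[R] Y) (s : R) (hs : ∀ y, g (h (g y)) = s • g y) :
    Y →ₗ[R] LinearMap.ker g :=
  (s • LinearMap.id - h ∘ₗ g).codRestrict _ fun y => by simp [hs]

lemma kerRetraction_comp_subtype (g : Y →ₗ[R] W) (h : W →ₗ[R] Y) (s : R)
    (hs : ∀ y, g (h (g y)) = s • g y) :
    kerRetraction g h s hs ∘ₗ (LinearMap.ker g).subtype = s • LinearMap.id := by
  ext z
  simp [kerRetraction]

variable (κ : Type*) [Field κ] [Algebra R κ]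

lemma subtype_baseChange_mem_ker (g : Y →ₗ[R] W) (ξ : κ ⊗[R] LinearMap.ker g) :
    (LinearMap.ker g).subtype.baseChange κ ξ ∈ LinearMap.ker (g.baseChange κ) := by
  rw [LinearMap.mem_ker, ← LinearMap.comp_apply, ← LinearMap.baseChange_comp,
    LinearMap.comp_ker_subtype, LinearMap.baseChange_zero, LinearMap.zero_apply]

/-- The map `κ ⊗ ker g → ker (κ ⊗ g) / im (κ ⊗ f)`. -/
def kerBaseChangeToSubquot (f : X →ₗ[R] Y) (g : Y →ₗ[R] W) :
    κ ⊗[R] LinearMap.ker g →ₗ[κ]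
      subquot (LinearMap.ker (g.baseChange κ)) (LinearMap.range (f.baseChange κ)) :=
  Submodule.mkQ _ ∘ₗ ((LinearMap.ker g).subtype.baseChange κ).codRestrict _
    (subtype_baseChange_mem_ker κ g)

lemma kerBaseChangeToSubquot_eq_zero_iff (f : X →ₗ[R] Y) (g : Y →ₗ[R] W)
    (ξ : κ ⊗[R] LinearMap.ker g) :
    kerBaseChangeToSubquot κ f g ξ = 0 ↔
      (LinearMap.ker g).subtype.baseChange κ ξ ∈ LinearMap.range (f.baseChange κ) := by
  rw [kerBaseChangeToSubquot, LinearMap.comp_apply, Submodule.mkQ_apply,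
    Submodule.Quotient.mk_eq_zero]
  rfl

/-- The natural map from the base change of the cohomology of `X → Y → W` to the cohomology of
the base change. -/
def subquotBaseChange (f : X →ₗ[R] Y) (g : Y →ₗ[R] W) :
    κ ⊗[R] subquot (LinearMap.ker g) (LinearMap.range f) →ₗ[κ]
      subquot (LinearMap.ker (g.baseChange κ)) (LinearMap.range (f.baseChange κ)) :=
  LinearMap.liftBaseChange κ <| Submodule.liftQ _
    ((kerBaseChangeToSubquot κ f g).restrictScalars R ∘ₗ TensorProduct.mk R κ _ 1) <| by
      rintro z ⟨x, hx⟩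
      refine (kerBaseChangeToSubquot_eq_zero_iff κ f g _).2 ⟨1 ⊗ₜ x, ?_⟩
      simpa using congrArg ((1 : κ) ⊗ₜ[R] ·) hx

lemma subquotBaseChange_baseChange_mkQ (f : X →ₗ[R] Y) (g : Y →ₗ[R] W)
    (ξ : κ ⊗[R] LinearMap.ker g) :
    subquotBaseChange κ f g ((Submodule.mkQ _).baseChange κ ξ) =
      kerBaseChangeToSubquot κ f g ξ := by
  induction ξ with
  | zero => simp
  | add a b ha hb => simp only [map_add, ha, hb]
  | tmul a z =>
    have : a ⊗ₜ[R] z = a • ((1 : κ) ⊗ₜ[R] z) := by simp [TensorProduct.smul_tmul']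
    rw [LinearMap.baseChange_tmul, this, map_smul]
    simp [subquotBaseChange]

lemma subquotBaseChange_tmul_mk (f : X →ₗ[R] Y) (g : Y →ₗ[R] W) (z : LinearMap.ker g) (a : κ)
    (w : LinearMap.ker (g.baseChange κ)) (hw : (w : κ ⊗[R] Y) = a ⊗ₜ[R] (z : Y)) :
    subquotBaseChange κ f g (a ⊗ₜ[R] Submodule.Quotient.mk z) = Submodule.Quotient.mk w := by
  refine (subquotBaseChange_baseChange_mkQ κ f g (a ⊗ₜ z)).trans ?_
  refine congrArg Submodule.Quotient.mk (Subtype.ext ?_)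
  simp [hw]

lemma subquotBaseChange_bijective (f : X →ₗ[R] Y) (g : Y →ₗ[R] W) (hgf : g ∘ₗ f = 0)
    (h : W →ₗ[R] Y) (s : R) (hs : ∀ y, g (h (g y)) = s • g y) (hs0 : algebraMap R κ s ≠ 0) :
    Function.Bijective (subquotBaseChange κ f g) := by
  have hmk : Function.Surjective ((Submodule.mkQ
      ((LinearMap.range f).comap (LinearMap.ker g).subtype)).baseChange κ) :=
    LinearMap.lTensor_surjective κ (Submodule.mkQ_surjective _)
  have hleft : ∀ ξ : κ ⊗[R] LinearMap.ker g, (kerRetraction g h s hs).baseChange κ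
      ((LinearMap.ker g).subtype.baseChange κ ξ) = algebraMap R κ s • ξ := fun ξ => by
    rw [← LinearMap.comp_apply, ← LinearMap.baseChange_comp, kerRetraction_comp_subtype,
      LinearMap.baseChange_smul, LinearMap.baseChange_id, LinearMap.smul_apply,
      LinearMap.id_apply, algebraMap_smul]
  have hinj : Function.Injective ((LinearMap.ker g).subtype.baseChange κ) := fun a b hab => by
    have := congrArg ((kerRetraction g h s hs).baseChange κ) hab
    rw [hleft, hleft] at this
    exact smul_right_injective _ hs0 this
  constructor
  · rw [injective_iff_map_eq_zero]
    intro η hη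
    obtain ⟨ξ, rfl⟩ := hmk η
    rw [subquotBaseChange_baseChange_mkQ, kerBaseChangeToSubquot_eq_zero_iff] at hη
    obtain ⟨x, hx⟩ := hη
    have hf : ∀ x, f x ∈ LinearMap.ker g := fun x => LinearMap.congr_fun hgf x
    have hξ : (f.codRestrict _ hf).baseChange κ x = ξ := by
      apply hinj
      rw [← hx, ← LinearMap.comp_apply, ← LinearMap.baseChange_comp,
        LinearMap.subtype_comp_codRestrict]
    rw [← hξ, ← LinearMap.comp_apply, ← LinearMap.baseChange_comp]
    have : Submodule.mkQ ((LinearMap.range f).comap (LinearMap.ker g).subtype) ∘ₗ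
        f.codRestrict _ hf = 0 := by
      ext x
      simp [Submodule.Quotient.mk_eq_zero]
    rw [this, LinearMap.baseChange_zero, LinearMap.zero_apply]
  · intro η
    obtain ⟨⟨w, hw⟩, rfl⟩ := Submodule.Quotient.mk_surjective _ η
    refine ⟨(Submodule.mkQ _).baseChange κ
      ((algebraMap R κ s)⁻¹ • (kerRetraction g h s hs).baseChange κ w), ?_⟩
    rw [subquotBaseChange_baseChange_mkQ]
    refine congrArg Submodule.Quotient.mk (Subtype.ext ?_)
    change (LinearMap.ker g).subtype.baseChange κ _ = w
    rw [map_smul, ← LinearMap.comp_apply, ← LinearMap.baseChange_comp, kerRetraction,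
      LinearMap.subtype_comp_codRestrict, LinearMap.baseChange_sub, LinearMap.baseChange_smul,
      LinearMap.baseChange_id, LinearMap.baseChange_comp, LinearMap.sub_apply,
      LinearMap.comp_apply, LinearMap.mem_ker.1 hw, map_zero, sub_zero, LinearMap.smul_apply,
      LinearMap.id_apply, ← algebraMap_smul κ s w, inv_smul_smul₀ hs0]

lemma notMem_support_of_subsingleton_tensorProduct {M : Type*} [AddCommGroup M] [Module R M]
    [Module.Finite R M] (p : Ideal R) [hp : p.IsPrime] [Algebra (R ⧸ p) κ]
    [IsScalarTower R (R ⧸ p) κ] [IsFractionRing (R ⧸ p) κ] [Subsingleton (κ ⊗[R] M)] :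
    (⟨p, hp⟩ : PrimeSpectrum R) ∉ Module.support R M := by
  rw [Module.mem_support_iff_nontrivial_residueField_tensorProduct, not_nontrivial_iff_subsingleton]
  let e : p.ResidueField ≃ₐ[R] κ :=
    (IsLocalization.algEquiv (nonZeroDivisors (R ⧸ p)) p.ResidueField κ).restrictScalars R
  exact (TensorProduct.congr e.toLinearEquiv (LinearEquiv.refl R M)).toEquiv.subsingleton

lemma exists_section_of_ker_baseChange_le_range [IsNoetherianRing R] [Module.Finite R Y]
    [Module.Free R Y] (p : Ideal R) [hp : p.IsPrime] [Algebra (R ⧸ p) κ]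
    [IsScalarTower R (R ⧸ p) κ] [IsFractionRing (R ⧸ p) κ]
    (f : X →ₗ[R] Y) (g : Y →ₗ[R] W) (hgf : g ∘ₗ f = 0)
    (h : W →ₗ[R] Y) (s : R) (hs : ∀ y, g (h (g y)) = s • g y) (hsp : s ∉ p)
    (hs0 : algebraMap R κ s ≠ 0)
    (hle : LinearMap.ker (g.baseChange κ) ≤ LinearMap.range (f.baseChange κ)) :
    ∃ t ∉ p, ∃ k : Y →ₗ[R] X, ∀ z ∈ LinearMap.ker g, f (k z) = t • z := by
  have : Subsingleton (subquot (LinearMap.ker (g.baseChange κ))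
      (LinearMap.range (f.baseChange κ))) :=
    Submodule.Quotient.subsingleton_iff.2 (Submodule.comap_subtype_eq_top.2 hle)
  have : Subsingleton (κ ⊗[R] subquot (LinearMap.ker g) (LinearMap.range f)) :=
    (subquotBaseChange_bijective κ f g hgf h s hs hs0).1.subsingleton
  have hsupp := notMem_support_of_subsingleton_tensorProduct κ
    (M := subquot (LinearMap.ker g) (LinearMap.range f)) p
  rw [Module.mem_support_iff_of_finite, SetLike.not_le_iff_exists] at hsupp
  obtain ⟨u, hu, hup⟩ := hsupp
  have hrange : ∀ z : LinearMap.ker g, u • (z : Y) ∈ LinearMap.range f := fun z => by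
    have := Module.mem_annihilator.1 hu (Submodule.Quotient.mk z)
    rwa [← Submodule.Quotient.mk_smul, Submodule.Quotient.mk_eq_zero] at this
  obtain ⟨k, hk⟩ := Module.projective_lifting_property f.rangeRestrict
    (((u • (LinearMap.ker g).subtype).codRestrict _ hrange) ∘ₗ kerRetraction g h s hs)
    f.surjective_rangeRestrict
  refine ⟨u * s, hp.mul_notMem hup hsp, k, fun z hz => ?_⟩
  have h1 := congrArg Subtype.val (LinearMap.congr_fun hk z)
  have h2 := LinearMap.congr_fun (kerRetraction_comp_subtype g h s hs) ⟨z, hz⟩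
  simp only [LinearMap.comp_apply, Submodule.subtype_apply] at h1 h2
  rw [h2] at h1
  rw [mul_smul]
  exact h1

end Splitting

/-- Let `R` be a commutative Noetherian ring, `C` a bounded cochain complex of
finitely generated free `R`-modules (differentials `d i : C i → C (i+1)`, `d ∘ d = 0`), `p` a
prime ideal of `R` with residue field `κ(p)` (the fraction field of `R ⧸ p`), and let
`i₀ = m + 1` be an integer (as `m` ranges over `ℤ`, `i₀` ranges over all integers; cohomology at
spot `j + 1` is `ker (d (j+1)) / im (d j)`).  Assume `H^i(C ⊗ κ(p)) = 0` for all `i ≥ i₀ + 1`.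
Then:
(1) for every `i ≥ i₀ + 1`, the localization `H^i(C)_p` vanishes, so `p` does not lie in the
support of the `R`-module `H^i(C)`; and
(2) the natural base-change map `H^{i₀}(C) ⊗_R κ(p) → H^{i₀}(C ⊗ κ(p))`, determined by
`λ ⊗ [z] ↦ [λ ⊗ z]`, is an isomorphism of `κ(p)`-vector spaces. -/
theorem stmt8 (R : Type*) [CommRing R] [IsNoetherianRing R]
    (C : ℤ → Type*) [∀ i, AddCommGroup (C i)] [∀ i, Module R (C i)]
    [∀ i, Module.Finite R (C i)] [∀ i, Module.Free R (C i)]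
    (d : ∀ i : ℤ, C i →ₗ[R] C (i + 1))
    (hdd : ∀ i : ℤ, (d (i + 1)).comp (d i) = 0)
    (hbdd : ∃ a b : ℤ, ∀ i : ℤ, (i < a ∨ b < i) → Subsingleton (C i))
    (p : Ideal R) [p.IsPrime]
    (κ : Type*) [Field κ] [Algebra R κ] [Algebra (R ⧸ p) κ]
    [IsScalarTower R (R ⧸ p) κ] [IsFractionRing (R ⧸ p) κ]
    (m : ℤ)
    (hvan : ∀ i : ℤ, m + 1 ≤ i →
      LinearMap.ker (LinearMap.baseChange κ (d (i + 1))) ≤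
        LinearMap.range (LinearMap.baseChange κ (d i))) :
    (∀ i : ℤ, m + 1 ≤ i →
      Subsingleton (LocalizedModule p.primeCompl
        (subquot (LinearMap.ker (d (i + 1))) (LinearMap.range (d i)))) ∧
      (⟨p, ‹p.IsPrime›⟩ : PrimeSpectrum R) ∉
        Module.support R (subquot (LinearMap.ker (d (i + 1))) (LinearMap.range (d i)))) ∧
    (∃ Φ : (κ ⊗[R] subquot (LinearMap.ker (d (m + 1))) (LinearMap.range (d m))) →ₗ[κ]
        subquot (LinearMap.ker (LinearMap.baseChange κ (d (m + 1))))
          (LinearMap.range (LinearMap.baseChange κ (d m))),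
      (∀ (z : LinearMap.ker (d (m + 1))) (lam : κ),
          ∃ w : LinearMap.ker (LinearMap.baseChange κ (d (m + 1))),
            (w : κ ⊗[R] C (m + 1)) = lam ⊗ₜ[R] (z : C (m + 1))) ∧
      (∀ (z : LinearMap.ker (d (m + 1))) (lam : κ)
          (w : LinearMap.ker (LinearMap.baseChange κ (d (m + 1)))),
          (w : κ ⊗[R] C (m + 1)) = lam ⊗ₜ[R] (z : C (m + 1)) →
            Φ (lam ⊗ₜ[R] Submodule.Quotient.mk z) = Submodule.Quotient.mk w) ∧
      Function.Bijective Φ) := by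
  have hκ : ∀ s ∉ p, algebraMap R κ s ≠ 0 := fun s hs h0 => by
    rw [IsScalarTower.algebraMap_apply R (R ⧸ p) κ, Ideal.Quotient.algebraMap_eq,
      FaithfulSMul.algebraMap_eq_zero_iff, Ideal.Quotient.eq_zero_iff_mem] at h0
    exact hs h0
  obtain ⟨a, b, hb⟩ := hbdd
  have key : ∀ (n : ℕ) (i : ℤ), b ≤ i + n → m + 1 ≤ i → ∃ s ∉ p, ∃ h : C (i + 1) →ₗ[R] C i,
      ∀ z ∈ LinearMap.ker (d (i + 1)), d i (h z) = s • z := by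
    intro n
    induction n with
    | zero =>
      intro i hi _
      have := hb (i + 1) (Or.inr (by push_cast at hi; omega))
      exact ⟨1, Ideal.one_notMem p, 0, fun z _ => Subsingleton.elim _ _⟩
    | succ n ih =>
      intro i hi hmi
      obtain ⟨s, hs, h, hh⟩ := ih (i + 1) (by push_cast at hi; omega) (by omega)
      exact exists_section_of_ker_baseChange_le_range κ p (d i) (d (i + 1)) (hdd i) h s
        (fun y => hh _ (LinearMap.congr_fun (hdd (i + 1)) y)) hs (hκ s hs) (hvan i hmi)
  have section_exists : ∀ i : ℤ, m + 1 ≤ i → ∃ s ∉ p, ∃ h : C (i + 1) →ₗ[R] C i,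
      ∀ z ∈ LinearMap.ker (d (i + 1)), d i (h z) = s • z :=
    fun i hi => key (b - i).toNat i (by omega) hi
  refine ⟨fun i hi => ?_, subquotBaseChange κ (d m) (d (m + 1)), fun z a => ?_,
    fun z a w hw => subquotBaseChange_tmul_mk κ _ _ z a w hw, ?_⟩
  · obtain ⟨s, hs, h, hh⟩ := section_exists i hi
    have hsupp : (⟨p, ‹p.IsPrime›⟩ : PrimeSpectrum R) ∉
        Module.support R (subquot (LinearMap.ker (d (i + 1))) (LinearMap.range (d i))) := by
      rw [Module.notMem_support_iff']
      intro x
      obtain ⟨z, rfl⟩ := Submodule.Quotient.mk_surjective _ x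
      refine ⟨s, hs, ?_⟩
      rw [← Submodule.Quotient.mk_smul, Submodule.Quotient.mk_eq_zero]
      exact ⟨h z, hh z z.2⟩
    exact ⟨Module.notMem_support_iff.1 hsupp, hsupp⟩
  · exact ⟨⟨a ⊗ₜ z, by simp⟩, rfl⟩
  · obtain ⟨s, hs, h, hh⟩ := section_exists (m + 1) le_rfl
    exact subquotBaseChange_bijective κ (d m) (d (m + 1)) (hdd m) h s
      (fun y => hh _ (LinearMap.congr_fun (hdd (m + 1)) y)) (hκ s hs)
end
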